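/- Let k ≥ 1, let F = GaloisField 2 (2k), let i ≥ 0 be an integer, and let t1, t2 be integers with 0 ≤ t1, t2 ≤ k. Assume that the only z in the subfield F_{2^k} with z^{2^{k−t1}} + z^{2^{k−t2}} + z = 0 is z = 0, and the only z ∈ F_{2^k} with z^{2^{t1}} + z^{2^{t2}} + z = 0 is z = 0. Then for α ∈ F, the Boolean function F_α^i(x) = Tr(α x^{2^i} (x + x^{2^k} + x^{2^{t1}} + x^{2^{t1+k}} + x^{2^{t2}} + x^{2^{t2+k}})) is bent if and only if α^{2^k} ≠ α. -/

import Mathlib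

open Finset

noncomputable instance (n : ℕ) : Fintype (GaloisField 2 n) := Fintype.ofFinite _

/-- The absolute trace of `GaloisField 2 n` over `ZMod 2`. -/
noncomputable def gTr (n : ℕ) : GaloisField 2 n → ZMod 2 :=
  Algebra.trace (ZMod 2) (GaloisField 2 n)

/-- A Boolean function on `GaloisField 2 n` is bent if all its Walsh values
square to `2^n`. -/
def IsBent {n : ℕ} (f : GaloisField 2 n → ZMod 2) : Prop :=
  ∀ lam : GaloisField 2 n,
    (∑ x : GaloisField 2 n, (-1 : ℤ) ^ (f x + gTr n (lam * x)).val) ^ 2 = 2 ^ n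

theorem neg_one_pow_val_add (a b : ZMod 2) :
    (-1 : ℤ) ^ (a + b).val = (-1) ^ a.val * (-1) ^ b.val := by
  revert a b; decide

theorem neg_one_pow_val_of_ne_zero {a : ZMod 2} (ha : a ≠ 0) : (-1 : ℤ) ^ a.val = -1 := by
  revert a; decide

/-- A signed sum vanishes when some translation flips the sign of every term. -/
theorem sum_neg_one_pow_val_eq_zero {G : Type*} [AddGroup G] [Fintype G] {g : G → ZMod 2} {v : G}
    {c : ZMod 2} (hc : c ≠ 0) (h : ∀ x, g (x + v) = g x + c) :
    ∑ x, (-1 : ℤ) ^ (g x).val = 0 := by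
  have hshift : ∑ x, (-1 : ℤ) ^ (g (x + v)).val = ∑ x, (-1 : ℤ) ^ (g x).val :=
    Equiv.sum_comp (Equiv.addRight v) fun x => (-1 : ℤ) ^ (g x).val
  simp only [h, neg_one_pow_val_add, neg_one_pow_val_of_ne_zero hc, ← Finset.sum_mul] at hshift
  linarith

section GaloisField

variable {n : ℕ}

theorem gTr_add (x y : GaloisField 2 n) : gTr n (x + y) = gTr n x + gTr n y :=
  map_add (Algebra.trace (ZMod 2) (GaloisField 2 n)) x y

theorem gTr_zero : gTr n 0 = 0 :=
  map_zero (Algebra.trace (ZMod 2) (GaloisField 2 n))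

theorem gTr_pow_two_pow (x : GaloisField 2 n) (m : ℕ) : gTr n (x ^ 2 ^ m) = gTr n x := by
  induction m with
  | zero => simp
  | succ m ih =>
    have h := Algebra.trace_eq_of_algEquiv
      (FiniteField.frobeniusAlgEquivOfAlgebraic (ZMod 2) (GaloisField 2 n)) (x ^ 2 ^ m)
    rw [FiniteField.coe_frobeniusAlgEquivOfAlgebraic] at h
    rw [pow_succ, pow_mul, ← ih]
    simpa [gTr, ZMod.card] using h

theorem eq_zero_of_gTr_mul_eq_zero {a : GaloisField 2 n} (h : ∀ x, gTr n (a * x) = 0) : a = 0 :=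
  (traceForm_nondegenerate (ZMod 2) (GaloisField 2 n)).1 a h

theorem add_pow_two_pow (x y : GaloisField 2 n) (m : ℕ) :
    (x + y) ^ 2 ^ m = x ^ 2 ^ m + y ^ 2 ^ m :=
  add_pow_char_pow x y 2 m

theorem pow_two_pow_self (hn : n ≠ 0) (x : GaloisField 2 n) : x ^ 2 ^ n = x := by
  have h := FiniteField.pow_card x
  rwa [← Nat.card_eq_fintype_card, GaloisField.card 2 n hn] at h

theorem exists_pow_two_pow_eq (w : GaloisField 2 n) (m : ℕ) :
    ∃ v : GaloisField 2 n, v ^ 2 ^ m = w := by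
  obtain ⟨v, hv⟩ := (bijective_iterateFrobenius (GaloisField 2 n) 2 m).2 w
  exact ⟨v, by rwa [iterateFrobenius_def] at hv⟩

/-- A function whose polarization is additive and nondegenerate is bent. -/
theorem isBent_of_polar (f : GaloisField 2 n → ZMod 2)
    (B : GaloisField 2 n → GaloisField 2 n → ZMod 2)
    (hn : n ≠ 0)
    (hf : ∀ x u, f (x + u) = f x + f u + B x u)
    (hB : ∀ x y u, B (x + y) u = B x u + B y u)
    (hnd : ∀ u, (∀ x, B x u = 0) → u = 0) : IsBent f := by
  intro lam
  have hB0 : B 0 0 = 0 := by simpa using hB 0 0 0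
  have h0 : f 0 = 0 := by simpa [hB0] using hf 0 0
  have hfB : ∀ x, B x 0 = 0 := fun x => by simpa [h0] using hf x 0
  have hcancel : ∀ a : ZMod 2, (-1 : ℤ) ^ a.val * (-1) ^ a.val = 1 := by decide
  have hterm : ∀ x u, (-1 : ℤ) ^ (f x + gTr n (lam * x)).val *
      (-1) ^ (f (x + u) + gTr n (lam * (x + u))).val =
      (-1) ^ (f u + gTr n (lam * u)).val * (-1) ^ (B x u).val := by
    intro x u
    rw [hf, mul_add, gTr_add]
    simp only [neg_one_pow_val_add]
    linear_combination (-1 : ℤ) ^ (f u).val * (-1) ^ (gTr n (lam * u)).val * (-1) ^ (B x u).val *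
      ((-1 : ℤ) ^ (f x).val * (-1) ^ (f x).val * hcancel (gTr n (lam * x)) + hcancel (f x))
  calc _ = ∑ x, ∑ u, (-1 : ℤ) ^ (f x + gTr n (lam * x)).val *
      (-1) ^ (f (x + u) + gTr n (lam * (x + u))).val := by
        rw [sq, Finset.sum_mul]
        refine Finset.sum_congr rfl fun x _ => ?_
        rw [← Finset.mul_sum]
        congr 1
        exact (Equiv.sum_comp (Equiv.addLeft x)
          fun u => (-1 : ℤ) ^ (f u + gTr n (lam * u)).val).symm
    _ = ∑ u, (-1 : ℤ) ^ (f u + gTr n (lam * u)).val * ∑ x, (-1) ^ (B x u).val := by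
        simp only [hterm]
        rw [Finset.sum_comm]
        simp only [Finset.mul_sum]
    _ = (-1 : ℤ) ^ (f 0 + gTr n (lam * 0)).val * ∑ x, (-1) ^ (B x 0).val := by
        refine Finset.sum_eq_single 0 (fun u _ hu => ?_) (by simp)
        obtain ⟨v, hv⟩ : ∃ v, B v u ≠ 0 := by
          by_contra! h
          exact hu (hnd u h)
        rw [sum_neg_one_pow_val_eq_zero hv fun x => hB x v u, mul_zero]
    _ = 2 ^ n := by
        simp only [mul_zero, gTr_zero, h0, hfB]
        simp [← Nat.card_eq_fintype_card, GaloisField.card 2 n hn]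

theorem not_isBent_of_add_one (f : GaloisField 2 n → ZMod 2) (h : ∀ x, f (x + 1) = f x) :
    ¬ IsBent f := by
  intro hf
  obtain ⟨lam, hlam⟩ : ∃ lam, gTr n lam ≠ 0 := by
    by_contra! h0
    exact one_ne_zero (eq_zero_of_gTr_mul_eq_zero (a := (1 : GaloisField 2 n)) fun x => h0 _)
  have hW := hf lam
  rw [sum_neg_one_pow_val_eq_zero (v := 1) hlam fun x => by
    rw [h, mul_add, mul_one, gTr_add, add_assoc]] at hW
  exact absurd hW (by positivity)

end GaloisField

section QuadraticExtension

variable {k : ℕ}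

theorem pow_two_pow_pow_two_pow (hk : 1 ≤ k) (x : GaloisField 2 (2 * k)) :
    (x ^ 2 ^ k) ^ 2 ^ k = x := by
  rw [← pow_mul, ← pow_add, ← two_mul, pow_two_pow_self (by lia)]

theorem relTrace_pow (hk : 1 ≤ k) (x : GaloisField 2 (2 * k)) :
    (x + x ^ 2 ^ k) ^ 2 ^ k = x + x ^ 2 ^ k := by
  rw [add_pow_two_pow, pow_two_pow_pow_two_pow hk, add_comm]

/-- The relative trace is self-adjoint for the absolute trace form. -/
theorem gTr_mul_relTrace (hk : 1 ≤ k) (a w : GaloisField 2 (2 * k)) :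
    gTr (2 * k) (a * (w + w ^ 2 ^ k)) = gTr (2 * k) ((a + a ^ 2 ^ k) * w) := by
  have h := gTr_pow_two_pow (a * w ^ 2 ^ k) k
  rw [mul_pow, pow_two_pow_pow_two_pow hk] at h
  rw [mul_add, add_mul, gTr_add, gTr_add, h]

theorem gTr_mul_pow_two_pow (hk : 1 ≤ k) {c : GaloisField 2 (2 * k)} (hc : c ^ 2 ^ k = c)
    {t : ℕ} (ht : t ≤ k) (x : GaloisField 2 (2 * k)) :
    gTr (2 * k) (c * x ^ 2 ^ t) = gTr (2 * k) (c ^ 2 ^ (k - t) * x) := by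
  rw [← gTr_pow_two_pow (c * x ^ 2 ^ t) (k + (k - t)), mul_pow, ← pow_mul x, ← pow_add,
    show t + (k + (k - t)) = 2 * k by lia, pow_two_pow_self (by lia), pow_add, pow_mul, hc]

theorem relTrace_mul {a c : GaloisField 2 (2 * k)} (hc : c ^ 2 ^ k = c) :
    a * c + (a * c) ^ 2 ^ k = (a + a ^ 2 ^ k) * c := by
  rw [mul_pow, hc, add_mul]

/-- The linear factor of the Boolean function is a linearized polynomial in the relative trace. -/
theorem linearFactor_eq (t1 t2 : ℕ) (x : GaloisField 2 (2 * k)) :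
    x + x ^ 2 ^ k + x ^ 2 ^ t1 + x ^ 2 ^ (t1 + k) + x ^ 2 ^ t2 + x ^ 2 ^ (t2 + k) =
      (x + x ^ 2 ^ k) ^ 2 ^ t1 + (x + x ^ 2 ^ k) ^ 2 ^ t2 + (x + x ^ 2 ^ k) := by
  simp only [add_pow_two_pow, ← pow_mul, ← pow_add, add_comm k]
  ring

theorem linearFactor_eq_relTrace (t1 t2 : ℕ) (x : GaloisField 2 (2 * k)) :
    x + x ^ 2 ^ k + x ^ 2 ^ t1 + x ^ 2 ^ (t1 + k) + x ^ 2 ^ t2 + x ^ 2 ^ (t2 + k) =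
      (x + x ^ 2 ^ t1 + x ^ 2 ^ t2) + (x + x ^ 2 ^ t1 + x ^ 2 ^ t2) ^ 2 ^ k := by
  simp only [add_pow_two_pow, ← pow_mul, ← pow_add]
  ring

end QuadraticExtension

theorem stmt_7 (k : ℕ) (hk : 1 ≤ k) (i t1 t2 : ℕ) (ht1 : t1 ≤ k) (ht2 : t2 ≤ k)
    (h1 : ∀ z : GaloisField 2 (2 * k), z ^ 2 ^ k = z →
      z ^ 2 ^ (k - t1) + z ^ 2 ^ (k - t2) + z = 0 → z = 0)
    (h2 : ∀ z : GaloisField 2 (2 * k), z ^ 2 ^ k = z →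
      z ^ 2 ^ t1 + z ^ 2 ^ t2 + z = 0 → z = 0)
    (α : GaloisField 2 (2 * k)) :
    IsBent (fun x : GaloisField 2 (2 * k) =>
      gTr (2 * k) (α * x ^ 2 ^ i *
        (x + x ^ 2 ^ k + x ^ 2 ^ t1 + x ^ 2 ^ (t1 + k) + x ^ 2 ^ t2 + x ^ 2 ^ (t2 + k)))) ↔
      α ^ 2 ^ k ≠ α := by
  set L : GaloisField 2 (2 * k) → GaloisField 2 (2 * k) := fun x =>
    x + x ^ 2 ^ k + x ^ 2 ^ t1 + x ^ 2 ^ (t1 + k) + x ^ 2 ^ t2 + x ^ 2 ^ (t2 + k) with hL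
  have hLadd : ∀ x y, L (x + y) = L x + L y := fun x y => by
    simp only [hL, add_pow_two_pow]
    ring
  have hLsub : ∀ x, x ^ 2 ^ k = x → L x = 0 := fun x hx => by
    simp only [hL, linearFactor_eq, hx, CharTwo.add_self_eq_zero]
    simp
  have hLmem : ∀ x, L x ^ 2 ^ k = L x := fun x => by
    simp only [hL, linearFactor_eq_relTrace, relTrace_pow hk]
  constructor
  · rintro hbent hα
    refine not_isBent_of_add_one _ (fun x => ?_) hbent
    change gTr (2 * k) (α * (x + 1) ^ 2 ^ i * L (x + 1)) = gTr (2 * k) (α * x ^ 2 ^ i * L x)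
    have h0 : gTr (2 * k) (α * L x) = 0 := by
      simp only [hL, linearFactor_eq_relTrace]
      rw [gTr_mul_relTrace hk, hα, CharTwo.add_self_eq_zero, zero_mul, gTr_zero]
    rw [hLadd, hLsub 1 (one_pow _), add_zero, add_pow_two_pow, one_pow, mul_add α, mul_one, add_mul,
      gTr_add, h0, add_zero]
  · intro hα
    have hTα : α + α ^ 2 ^ k ≠ 0 := fun h => hα (CharTwo.add_eq_zero.1 h).symm
    refine isBent_of_polar _
      (fun x u => gTr (2 * k) (α * x ^ 2 ^ i * L u) + gTr (2 * k) (α * u ^ 2 ^ i * L x))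
      (by lia) (fun x u => ?_) (fun x y u => ?_) fun u hu => ?_
    · change gTr (2 * k) (α * (x + u) ^ 2 ^ i * L (x + u)) =
        gTr (2 * k) (α * x ^ 2 ^ i * L x) + gTr (2 * k) (α * u ^ 2 ^ i * L u) + _
      simp only [hLadd, add_pow_two_pow, mul_add, add_mul, gTr_add]
      ring
    · simp only [hLadd, add_pow_two_pow, mul_add, add_mul, gTr_add]
      ring
    · have hLu : L u = 0 := by
        have h : (α * L u) + (α * L u) ^ 2 ^ k = 0 := by
          refine eq_zero_of_gTr_mul_eq_zero fun w => ?_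
          obtain ⟨v, rfl⟩ := exists_pow_two_pow_eq w i
          have hv := hu (v + v ^ 2 ^ k)
          simp only [hLsub _ (relTrace_pow hk v), mul_zero, gTr_zero, add_zero] at hv
          rw [← gTr_mul_relTrace hk, ← hv, add_pow_two_pow, pow_right_comm v]
          ring_nf
        rw [relTrace_mul (hLmem u)] at h
        exact (mul_eq_zero.1 h).resolve_left hTα
      have huk : u ^ 2 ^ k = u := by
        have h := h2 _ (relTrace_pow hk u) (by rw [← linearFactor_eq]; exact hLu)
        exact (CharTwo.add_eq_zero.1 h).symm
      set b := α * u ^ 2 ^ i with hb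
      have hc := relTrace_pow hk b
      have hTb : b + b ^ 2 ^ k = 0 := by
        refine h1 _ hc (eq_zero_of_gTr_mul_eq_zero fun x => ?_)
        have hx := hu x
        simp only [hLu, mul_zero, gTr_zero, zero_add] at hx
        simp only [hL, linearFactor_eq_relTrace] at hx
        rw [gTr_mul_relTrace hk, mul_add, mul_add, gTr_add, gTr_add,
          gTr_mul_pow_two_pow hk hc ht1, gTr_mul_pow_two_pow hk hc ht2] at hx
        rw [add_mul, add_mul, gTr_add, gTr_add, ← hx]
        ring
      rw [hb, relTrace_mul (by rw [pow_right_comm, huk])] at hTb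
      exact eq_zero_of_pow_eq_zero ((mul_eq_zero.1 hTb).resolve_left hTα)
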